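/- In R = A[[h]], let P := 1 - 2h·b₊ and for α ∈ ℚ define P^{α} := Σ_{n≥0} binom(α,n)(-2h·b₊)ⁿ. Set E := P^{-1/4}e, H := P^{1/2}h̄, T := P^{-1/2}, T⁻¹ := P^{1/2}, and F := P^{1/4}f - (h²/4)·b₊·P^{-3/4}e + (h/2)·P^{1/4}e·h̄. Then the Jordanian U_h(osp(1|2)) relations hold: HE - EH = (1/2)(T+T⁻¹)E; EF + FE = -(1/4)(T+T⁻¹)H - (1/4)H(T+T⁻¹); HT^{±1} - T^{±1}H = T^{±2} - 1; 2hE² = T - T⁻¹; T^{±1}F - FT^{±1} = ±(h/2)(T^{±2}+1)E; and HF - FH = -(1/4)(T+T⁻¹)F - (1/4)F(T+T⁻¹) - (h/8)((T-T⁻¹)H + H(T-T⁻¹))E - (h/8)E((T-T⁻¹)H + H(T-T⁻¹)). -/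

import Mathlib

noncomputable section

/-- The generalized binomial coefficient `α(α-1)⋯(α-n+1)/n!`. -/
def qbinom (α : ℚ) (n : ℕ) : ℚ :=
  (∏ i ∈ Finset.range n, (α - (i : ℚ))) / (n.factorial : ℚ)

/-- `P^α := Σ_{n≥0} binom(α,n)(-2h·b₊)ⁿ` in `A[[h]]`, where `P = 1 - 2h·b₊`. -/
def Ppow {A : Type*} [Ring A] [Algebra ℂ A] (b : A) (α : ℚ) : PowerSeries A :=
  PowerSeries.mk fun m =>
    (((qbinom α m : ℚ) : ℂ) * (-2 : ℂ) ^ m) • b ^ m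

/-- The Jordanian `U_h(osp(1|2))` relations in terms of a fourth root `p` of `P = 1 - 2he²`, its
inverse `q`, and the commutation relations of `p` and `q` with the generators of `osp(1|2)`. -/
theorem jordanian_relations_of_fourth_root {R : Type*} [Ring R] [Algebra ℂ R] (h p q e u f : R)
    (hp : h * p = p * h) (hq : h * q = q * h) (he : e * h = h * e) (hu : u * h = h * u)
    (pq : p * q = 1) (qp : q * p = 1) (ep : e * p = p * e)
    (eq : e * q = q * e)
    (up : u * p = p * u + (1 / 2 : ℂ) • (p - q * (q * q)))
    (uq : u * q = q * u - (1 / 2 : ℂ) • (q - q * (q * (q * (q * q)))))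
    (fp : f * p = p * f + (1 / 2 : ℂ) • (q * (q * (q * (h * e)))))
    (fq : f * q = q * f - (1 / 2 : ℂ) • (q * (q * (q * (q * (q * (h * e)))))))
    (hee : h * (e * e) = (1 / 2 : ℂ) • (1 - p * (p * (p * p))))
    (ue : u * e = e * u + e) (fu : f * u = u * f + f) (fe : f * e = -(e * f) - u)
    {E H F T Tinv : R} (hE : E = q * e) (hH : H = p * p * u) (hT : T = q * q)
    (hTinv : Tinv = p * p)
    (hF : F = p * f - (1 / 4 : ℂ) • (h ^ 2 * (e ^ 2 * (q * q * q) * e)) +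
      (1 / 2 : ℂ) • (h * (p * (e * u)))) :
    H * E - E * H = (1 / 2 : ℂ) • ((T + Tinv) * E) ∧
    E * F + F * E =
      -((1 / 4 : ℂ) • ((T + Tinv) * H)) - (1 / 4 : ℂ) • (H * (T + Tinv)) ∧
    H * T - T * H = T ^ 2 - 1 ∧
    H * Tinv - Tinv * H = Tinv ^ 2 - 1 ∧
    (2 : ℂ) • (h * E ^ 2) = T - Tinv ∧
    T * F - F * T = (1 / 2 : ℂ) • (h * ((T ^ 2 + 1) * E)) ∧
    Tinv * F - F * Tinv = -((1 / 2 : ℂ) • (h * ((Tinv ^ 2 + 1) * E))) ∧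
    H * F - F * H =
      -((1 / 4 : ℂ) • ((T + Tinv) * F)) - (1 / 4 : ℂ) • (F * (T + Tinv)) -
        (1 / 8 : ℂ) • (h * (((T - Tinv) * H + H * (T - Tinv)) * E)) -
        (1 / 8 : ℂ) • (h * (E * ((T - Tinv) * H + H * (T - Tinv)))) := by
  have hp' (y : R) : h * (p * y) = p * (h * y) := by rw [← mul_assoc, hp, mul_assoc]
  have hq' (y : R) : h * (q * y) = q * (h * y) := by rw [← mul_assoc, hq, mul_assoc]
  have he' (y : R) : e * (h * y) = h * (e * y) := by rw [← mul_assoc, he, mul_assoc]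
  have hu' (y : R) : u * (h * y) = h * (u * y) := by rw [← mul_assoc, hu, mul_assoc]
  have pq' (y : R) : p * (q * y) = y := by rw [← mul_assoc, pq, one_mul]
  have qp' (y : R) : q * (p * y) = y := by rw [← mul_assoc, qp, one_mul]
  have ep' (y : R) : e * (p * y) = p * (e * y) := by rw [← mul_assoc, ep, mul_assoc]
  have eq' (y : R) : e * (q * y) = q * (e * y) := by rw [← mul_assoc, eq, mul_assoc]
  have up' (y : R) : u * (p * y) = (p * u + (1 / 2 : ℂ) • (p - q * (q * q))) * y := by
    rw [← mul_assoc, up]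
  have uq' (y : R) :
      u * (q * y) = (q * u - (1 / 2 : ℂ) • (q - q * (q * (q * (q * q))))) * y := by
    rw [← mul_assoc, uq]
  have fp' (y : R) : f * (p * y) = (p * f + (1 / 2 : ℂ) • (q * (q * (q * (h * e))))) * y := by
    rw [← mul_assoc, fp]
  have fq' (y : R) :
      f * (q * y) = (q * f - (1 / 2 : ℂ) • (q * (q * (q * (q * (q * (h * e))))))) * y := by
    rw [← mul_assoc, fq]
  have hee' (y : R) : h * (e * (e * y)) = (1 / 2 : ℂ) • ((1 - p * (p * (p * p))) * y) := by
    rw [← smul_mul_assoc, ← hee]; simp only [mul_assoc]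
  have ue' (y : R) : u * (e * y) = (e * u + e) * y := by rw [← mul_assoc, ue]
  subst hE hH hT hTinv hF
  refine ⟨?_, ?_, ?_, ?_, ?_, ?_, ?_, ?_⟩ <;>
  · simp only [pow_two, mul_assoc, mul_add, add_mul, mul_sub, sub_mul, mul_neg, mul_one,
      one_mul, smul_mul_assoc, mul_smul_comm, pq, qp, ep, eq, up, uq, fp, fq,
      hee, ue, fu, fe, hp', hq', he', hu', pq', qp', ep', eq', up', uq', fp', fq', hee', ue']
    module

theorem qbinom_eq_choose (α : ℚ) (n : ℕ) : qbinom α n = Ring.choose α n := by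
  rw [Ring.choose_eq_smul, ← Polynomial.aeval_eq_smeval, Polynomial.aeval_def,
    Polynomial.eval₂_eq_eval_map, descPochhammer_map, descPochhammer_eval_eq_prod_range,
    qbinom, div_eq_inv_mul, smul_eq_mul]

theorem succ_mul_qbinom_succ (α : ℚ) (n : ℕ) :
    (n + 1) * qbinom α (n + 1) = α * qbinom (α - 1) n := by
  have hn : (n.factorial : ℚ) ≠ 0 := by positivity
  rw [qbinom, qbinom, Finset.prod_range_succ', Nat.factorial_succ]
  push_cast
  simp only [sub_sub, add_comm (1 : ℚ), sub_zero]
  field_simp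

theorem qbinom_succ (α : ℚ) (n : ℕ) :
    qbinom α (n + 1) = qbinom (α - 1) n + qbinom (α - 1) (n + 1) := by
  simpa [qbinom_eq_choose] using Ring.choose_succ_succ (α - 1) n

theorem qbinom_add (α β : ℚ) (n : ℕ) :
    qbinom (α + β) n =
      ∑ ij ∈ Finset.HasAntidiagonal.antidiagonal n, qbinom α ij.1 * qbinom β ij.2 := by
  simp only [qbinom_eq_choose, Ring.add_choose_eq n (Commute.all α β)]

section Ppow

open PowerSeries

variable {A : Type*} [Ring A] [Algebra ℂ A]

theorem Ppow_add (b : A) (α β : ℚ) : Ppow b (α + β) = Ppow b α * Ppow b β := by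
  ext n
  simp only [Ppow, coeff_mk, coeff_mul, smul_mul_smul_comm, qbinom_add, ← pow_add]
  push_cast
  rw [Finset.sum_mul, Finset.sum_smul]
  refine Finset.sum_congr rfl fun ij hij => ?_
  obtain rfl := Finset.HasAntidiagonal.mem_antidiagonal.mp hij
  congr 1
  ring

theorem Ppow_zero (b : A) : Ppow b 0 = 1 := by
  ext n
  cases n <;> simp [Ppow, qbinom, Finset.prod_range_succ', coeff_one]

theorem Ppow_one (b : A) : Ppow b 1 = 1 - (2 : ℂ) • (X * C b) := by
  ext n
  rcases n with _ | _ | n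
  · simp [Ppow, qbinom]
  · simp [Ppow, qbinom, coeff_one]
  · simp [Ppow, qbinom, Finset.prod_range_succ', coeff_one, coeff_X]

theorem Ppow_commute_C {b a : A} (h : Commute a b) (α : ℚ) :
    C a * Ppow b α = Ppow b α * C a := by
  ext n
  simp [Ppow, (h.pow_right n).eq]

/-- If `a` acts on `b` by `[a, b] = 2b`, then `[a, P^α] = 2α(P^α - P^{α-1})`. -/
theorem C_mul_Ppow_of_weight_two {a b : A} (h : a * b - b * a = 2 * b) (α : ℚ) :
    C a * Ppow b α = Ppow b α * C a + (2 * α : ℂ) • (Ppow b α - Ppow b (α - 1)) := by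
  have hpow (n : ℕ) : a * b ^ n = b ^ n * a + (2 * n : ℂ) • b ^ n := by
    induction n with
    | zero => simp
    | succ n ih =>
      have h' : a * b = b * a + (2 : ℂ) • b := by
        rw [ofNat_smul_eq_nsmul ℂ 2 b, nsmul_eq_mul]
        exact sub_eq_iff_eq_add'.mp h
      rw [pow_succ, ← mul_assoc, ih, add_mul, mul_assoc, h', mul_add, smul_mul_assoc,
        mul_smul_comm, mul_assoc]
      push_cast
      module
  ext n
  simp only [Ppow, coeff_C_mul, coeff_mul_C, coeff_mk, map_add, map_sub, coeff_smul,
    mul_smul_comm, smul_mul_assoc, hpow, smul_add]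
  congr 1
  rw [← sub_smul, smul_smul, smul_smul]
  congr 1
  cases n with
  | zero => simp [qbinom]
  | succ n =>
    have h₁ := congrArg (Rat.cast : ℚ → ℂ) (succ_mul_qbinom_succ α n)
    have h₂ := congrArg (Rat.cast : ℚ → ℂ) (qbinom_succ α n)
    push_cast at h₁ h₂ ⊢
    linear_combination (2 * (-2 : ℂ) ^ (n + 1)) * h₁ - (2 * α * (-2 : ℂ) ^ (n + 1)) * h₂

/-- If `[b, a] = c` with `c` commuting with `b`, then `[a, P^α] = 2αhP^{α-1}c`. -/
theorem C_mul_Ppow_of_commutator {a b c : A} (h : b * a - a * b = c) (hc : Commute c b)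
    (α : ℚ) :
    C a * Ppow b α = Ppow b α * C a + (2 * α : ℂ) • (Ppow b (α - 1) * (X * C c)) := by
  have hpow (n : ℕ) : a * b ^ (n + 1) = b ^ (n + 1) * a - ((n + 1 : ℕ) : ℂ) • (b ^ n * c) := by
    induction n with
    | zero => simp [← h]
    | succ n ih =>
      have h' : a * b = b * a - c := by rw [← h]; abel
      have hbc : b ^ n * c * b = b ^ (n + 1) * c := by
        rw [mul_assoc, hc.eq, ← mul_assoc, ← pow_succ]
      rw [pow_succ b (n + 1), ← mul_assoc, ih, sub_mul, mul_assoc, h', mul_sub,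
        smul_mul_assoc, hbc, ← mul_assoc]
      push_cast
      module
  ext n
  rw [← mul_assoc, ← X_mul, mul_assoc]
  cases n with
  | zero => simp [Ppow, qbinom]
  | succ n =>
    simp only [Ppow, coeff_C_mul, coeff_mul_C, coeff_mk, map_add, coeff_smul,
      coeff_succ_X_mul, mul_smul_comm, smul_mul_assoc, hpow, smul_sub]
    rw [sub_eq_add_neg]
    congr 1
    rw [smul_smul, smul_smul, ← neg_smul]
    congr 1
    have h₁ := congrArg (Rat.cast : ℚ → ℂ) (succ_mul_qbinom_succ α n)
    push_cast at h₁ ⊢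
    linear_combination (-(-2 : ℂ) ^ (n + 1)) * h₁

end Ppow

/-- In `R = A[[h]]`, with `b₊ := e²`, `P := 1 - 2h·b₊`, `E := P^{-1/4}e`,
`H := P^{1/2}h̄`, `T := P^{-1/2}`, `T⁻¹ := P^{1/2}`,
`F := P^{1/4}f - (h²/4)b₊P^{-3/4}e + (h/2)P^{1/4}e·h̄`, the Jordanian
`U_h(osp(1|2))` relations hold (the 'minimal twist map' realization).  Here `A`
is any unital associative `ℂ`-algebra containing elements `h̄, e, f` with the
`osp(1|2)` relations. -/
theorem statement_14 (A : Type*) [Ring A] [Algebra ℂ A] (hb e f : A)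
    (rel1 : hb * e - e * hb = e)
    (rel2 : hb * f - f * hb = -f)
    (rel3 : e * f + f * e = -hb) :
    ∀ E H F T Tinv : PowerSeries A,
      E = Ppow (e ^ 2) (-(1/4)) * PowerSeries.C e →
      H = Ppow (e ^ 2) (1/2) * PowerSeries.C hb →
      T = Ppow (e ^ 2) (-(1/2)) →
      Tinv = Ppow (e ^ 2) (1/2) →
      F = Ppow (e ^ 2) (1/4) * PowerSeries.C f -
            (1/4 : ℂ) • (PowerSeries.X ^ 2 *
              (PowerSeries.C (e ^ 2) * Ppow (e ^ 2) (-(3/4)) * PowerSeries.C e)) +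
            (1/2 : ℂ) • (PowerSeries.X *
              (Ppow (e ^ 2) (1/4) * PowerSeries.C (e * hb))) →
      (H * E - E * H = (1/2 : ℂ) • ((T + Tinv) * E) ∧
       E * F + F * E =
         -((1/4 : ℂ) • ((T + Tinv) * H)) - (1/4 : ℂ) • (H * (T + Tinv)) ∧
       H * T - T * H = T ^ 2 - 1 ∧
       H * Tinv - Tinv * H = Tinv ^ 2 - 1 ∧
       (2 : ℂ) • (PowerSeries.X * E ^ 2) = T - Tinv ∧
       T * F - F * T = (1/2 : ℂ) • (PowerSeries.X * ((T ^ 2 + 1) * E)) ∧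
       Tinv * F - F * Tinv = -((1/2 : ℂ) • (PowerSeries.X * ((Tinv ^ 2 + 1) * E))) ∧
       H * F - F * H =
         -((1/4 : ℂ) • ((T + Tinv) * F)) - (1/4 : ℂ) • (F * (T + Tinv)) -
           (1/8 : ℂ) • (PowerSeries.X * (((T - Tinv) * H + H * (T - Tinv)) * E)) -
           (1/8 : ℂ) • (PowerSeries.X * (E * ((T - Tinv) * H + H * (T - Tinv))))) := by
  intro E H F T Tinv hE hH hT hTinv hF
  have he : Commute e (e ^ 2) := (Commute.refl e).pow_right 2
  have hue : hb * e = e * hb + e := sub_eq_iff_eq_add'.mp rel1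
  have hfe : f * e = -(e * f) - hb := by rw [sub_eq_add_neg, ← rel3]; abel
  have hfu : f * hb = hb * f + f := by
    rw [← neg_eq_iff_eq_neg, neg_sub] at rel2
    exact sub_eq_iff_eq_add'.mp rel2
  have hweight : hb * e ^ 2 - e ^ 2 * hb = 2 * e ^ 2 := by
    rw [pow_two, ← mul_assoc, hue, add_mul, mul_assoc, hue]
    noncomm_ring
  have hcomm : e ^ 2 * f - f * e ^ 2 = e := by
    rw [pow_two, ← mul_assoc, hfe, sub_mul, neg_mul, mul_assoc, mul_assoc, hfe, hue]
    noncomm_ring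
  have hp3 : Ppow (e ^ 2) (-(3 / 4)) =
      Ppow (e ^ 2) (-(1 / 4)) * (Ppow (e ^ 2) (-(1 / 4)) * Ppow (e ^ 2) (-(1 / 4))) := by
    rw [← Ppow_add, ← Ppow_add]; norm_num
  have hp5 : Ppow (e ^ 2) (-(5 / 4)) =
      Ppow (e ^ 2) (-(1 / 4)) * (Ppow (e ^ 2) (-(1 / 4)) * (Ppow (e ^ 2) (-(1 / 4)) *
        (Ppow (e ^ 2) (-(1 / 4)) * Ppow (e ^ 2) (-(1 / 4))))) := by
    simp only [← Ppow_add]; norm_num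
  have hpp : Ppow (e ^ 2) (1 / 2) = Ppow (e ^ 2) (1 / 4) * Ppow (e ^ 2) (1 / 4) := by
    rw [← Ppow_add]; norm_num
  have hqq : Ppow (e ^ 2) (-(1 / 2)) = Ppow (e ^ 2) (-(1 / 4)) * Ppow (e ^ 2) (-(1 / 4)) := by
    rw [← Ppow_add]; norm_num
  refine jordanian_relations_of_fourth_root PowerSeries.X (Ppow (e ^ 2) (1 / 4))
    (Ppow (e ^ 2) (-(1 / 4))) (PowerSeries.C e) (PowerSeries.C hb) (PowerSeries.C f)
    PowerSeries.X_mul PowerSeries.X_mul PowerSeries.X_mul.symm PowerSeries.X_mul.symm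
    ?_ ?_ (Ppow_commute_C he _) (Ppow_commute_C he _) ?_ ?_ ?_ ?_ ?_ ?_ ?_ ?_ hE ?_ ?_ ?_ ?_
  · rw [← Ppow_add, add_neg_cancel, Ppow_zero]
  · rw [← Ppow_add, neg_add_cancel, Ppow_zero]
  · rw [C_mul_Ppow_of_weight_two hweight, ← hp3]
    norm_num
  · rw [C_mul_Ppow_of_weight_two hweight, ← hp5]
    norm_num [sub_eq_add_neg, add_comm]
  · rw [C_mul_Ppow_of_commutator hcomm he]
    simp only [← mul_assoc] at hp3 ⊢
    rw [← hp3]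
    norm_num
  · rw [C_mul_Ppow_of_commutator hcomm he]
    simp only [← mul_assoc] at hp5 ⊢
    rw [← hp5]
    norm_num [sub_eq_add_neg]
  · have h1 : Ppow (e ^ 2) 1 = Ppow (e ^ 2) (1 / 4) * (Ppow (e ^ 2) (1 / 4) *
        (Ppow (e ^ 2) (1 / 4) * Ppow (e ^ 2) (1 / 4))) := by
      simp only [← Ppow_add]; norm_num
    rw [← h1, Ppow_one, ← map_mul, ← pow_two]
    module
  · rw [← map_mul, hue, map_add, map_mul]
  · rw [← map_mul, hfu, map_add, map_mul]
  · rw [← map_mul, hfe, map_sub, map_neg, map_mul]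
  · rw [hH, hpp]
  · rw [hT, hqq]
  · rw [hTinv, hpp]
  · rw [hF, hp3, map_mul, map_pow]
    simp only [mul_assoc]
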